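/- arXiv:1902.07078 — 2 statements merged into one kernel-verified Lean document; each statement's English description precedes it below -/
import Mathlib

section
/- For each σ ∈ {L,M,R}* there exists a suffix w of the finite word σ(1) such that, for every u ∈ {0,1}^ℕ with inf O(u) = inf₁(u), one has inf₁(σ(u)) = inf O(σ(u)) = w·σ(inf O(u)), where w·σ(inf O(u)) denotes the concatenation of the finite word w with the infinite word σ(inf O(u)). -/
/-- `π_β(u)` for a binary sequence `u = u₁u₂⋯` (indexed from 0). -/
noncomputable def piB (β : ℝ) (u : ℕ → Bool) : ℝ :=
  ∑' k : ℕ, (if u k then (1 : ℝ) else 0) / β ^ (k + 1)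

/-- `π_β(u)` for a real digit sequence. -/
noncomputable def piR (β : ℝ) (u : ℕ → ℝ) : ℝ := ∑' k : ℕ, u k / β ^ (k + 1)

/-- A binary sequence viewed as a real digit sequence. -/
def bR (u : ℕ → Bool) : ℕ → ℝ := fun k => if u k then 1 else 0

/-- `U_β(A)`: sequences with digits in `A` whose `π_β`-value has no other expansion over `A`. -/
def Uset (β : ℝ) (A : Set ℝ) : Set (ℕ → ℝ) :=
  {u | (∀ k, u k ∈ A) ∧ ∀ v : ℕ → ℝ, (∀ k, v k ∈ A) → v ≠ u → piR β v ≠ piR β u}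

/-- `𝓛(m) = inf {β > 1 : U_β(m) ∩ {0,1}^ℕ is uncountable}`. -/
noncomputable def Lval (m : ℝ) : ℝ :=
  sInf {β : ℝ | 1 < β ∧ ¬ (Uset β {0, 1, m} ∩ {v | ∃ u : ℕ → Bool, v = bR u}).Countable}

/-- The shift orbit `O(u)` of an infinite binary word. -/
def orbit (u : ℕ → Bool) : Set (ℕ → Bool) := {v | ∃ k : ℕ, v = fun i => u (i + k)}

/-- Suffixes of `u` preceded by the letter `1`. -/
def orbit1 (u : ℕ → Bool) : Set (ℕ → Bool) :=
  {v | ∃ k : ℕ, u k = true ∧ v = fun i => u (i + k + 1)}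

/-- Suffixes of `u` preceded by the letter `0`. -/
def orbit0 (u : ℕ → Bool) : Set (ℕ → Bool) :=
  {v | ∃ k : ℕ, u k = false ∧ v = fun i => u (i + k + 1)}

open Classical in
/-- The lexicographic supremum of a set of binary sequences (greedy construction);
`⊥ = 0̄` for the empty set. -/
noncomputable def lexSupSeq (S : Set (ℕ → Bool)) : ℕ → Bool
  | n => decide (∃ u ∈ S, (∀ i, i < n → u i = lexSupSeq S i) ∧ u n = true)
  termination_by n => n

open Classical in
/-- The lexicographic infimum of a set of binary sequences (greedy construction);
`⊤ = 1̄` for the empty set. -/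
noncomputable def lexInfSeq (S : Set (ℕ → Bool)) : ℕ → Bool
  | n => decide (¬ ∃ u ∈ S, (∀ i, i < n → u i = lexInfSeq S i) ∧ u n = false)
  termination_by n => n

/-- `sup O(u)`, the lexicographically largest limit of suffixes of `u`. -/
noncomputable def supO (u : ℕ → Bool) : ℕ → Bool := lexSupSeq (orbit u)
/-- `inf O(u)`. -/
noncomputable def infO (u : ℕ → Bool) : ℕ → Bool := lexInfSeq (orbit u)
/-- `sup₀(u)`, the supremum of the suffixes preceded by `0`. -/
noncomputable def sup0 (u : ℕ → Bool) : ℕ → Bool := lexSupSeq (orbit0 u)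
/-- `inf₁(u)`, the infimum of the suffixes preceded by `1`. -/
noncomputable def inf1 (u : ℕ → Bool) : ℕ → Bool := lexInfSeq (orbit1 u)

/-- Strict lexicographic order on infinite binary words. -/
def lexLt (u v : ℕ → Bool) : Prop := ∃ n, (∀ i, i < n → u i = v i) ∧ u n < v n
/-- Lexicographic order on infinite binary words. -/
def lexLe (u v : ℕ → Bool) : Prop := lexLt u v ∨ u = v

/-- `f_u(m)`: the unique `β ≥ 1` with `β·π_β(sup O(u)) = m`. -/
noncomputable def fVal (u : ℕ → Bool) (m : ℝ) : ℝ :=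
  sInf {β : ℝ | 1 ≤ β ∧ β * piB β (supO u) = m}

/-- `g_u(m)`: the unique `β > 1` with `(β-1)(1+π_β(inf O(u))) = m`. -/
noncomputable def gVal (u : ℕ → Bool) (m : ℝ) : ℝ :=
  sInf {β : ℝ | 1 < β ∧ (β - 1) * (1 + piB β (infO u)) = m}

/-- `μ_u`: the unique `m ∈ (1,2]` with `f_u(m) = g_u(m)`. -/
noncomputable def muVal (u : ℕ → Bool) : ℝ :=
  sInf {m : ℝ | 1 < m ∧ m ≤ 2 ∧ fVal u m = gVal u m}

/-- `u` contains at least two ones. -/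
def TwoOnes (u : ℕ → Bool) : Prop := ∃ k l, k < l ∧ u k = true ∧ u l = true

/-- The substitution `L : 0 ↦ 0, 1 ↦ 01` (with `0 = false`, `1 = true`). -/
def Lsub : Bool → List Bool := fun b => if b then [false, true] else [false]
/-- The substitution `M : 0 ↦ 01, 1 ↦ 10`. -/
def Msub : Bool → List Bool := fun b => if b then [true, false] else [false, true]
/-- The substitution `R : 0 ↦ 01, 1 ↦ 1`. -/
def Rsub : Bool → List Bool := fun b => if b then [true] else [false, true]
/-- The identity substitution. -/
def idSub : Bool → List Bool := fun b => [b]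
/-- Composition of substitutions: `compSub σ τ = σ ∘ τ` (apply `τ` first). -/
def compSub (σ τ : Bool → List Bool) : Bool → List Bool := fun b => (τ b).flatMap σ

/-- The monoid `{L,M,R}*` generated by the three substitutions. -/
def LMRstar : Set (Bool → List Bool) :=
  {σ | ∃ l : List (Bool → List Bool),
    (∀ τ ∈ l, τ = Lsub ∨ τ = Msub ∨ τ = Rsub) ∧ σ = l.foldr compSub idSub}

/-- A substitution applied to an infinite word, `σ(u₁)σ(u₂)⋯`. -/
noncomputable def substApply (σ : Bool → List Bool) (u : ℕ → Bool) : ℕ → Bool := fun n =>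
  let k := sSup {k : ℕ | (∑ i ∈ Finset.range k, (σ (u i)).length) ≤ n}
  (σ (u k)).getD (n - ∑ i ∈ Finset.range k, (σ (u i)).length) false

/-- `u` is a limit word of the sequence of substitutions `σseq`. -/
def IsLimitWord (σseq : ℕ → Bool → List Bool) (u : ℕ → Bool) : Prop :=
  ∃ useq : ℕ → ℕ → Bool, useq 0 = u ∧ ∀ n, useq n = substApply (σseq n) (useq (n + 1))

/-- Primitivity of a sequence of substitutions in `{L,M,R}^ℕ`: no tail is constantly `L`
and no tail is constantly `R`. -/
def PrimitiveSeq (σseq : ℕ → Bool → List Bool) : Prop :=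
  (¬ ∃ k, ∀ n, k ≤ n → σseq n = Lsub) ∧ ¬ ∃ k, ∀ n, k ≤ n → σseq n = Rsub

/-- `S_{L,M,R}`: the set of limit words of primitive sequences of substitutions. -/
def Sset : Set (ℕ → Bool) :=
  {u | ∃ σseq : ℕ → Bool → List Bool,
    (∀ n, σseq n = Lsub ∨ σseq n = Msub ∨ σseq n = Rsub) ∧
    PrimitiveSeq σseq ∧ IsLimitWord σseq u}

/-- The word `1 0̄ = 1000⋯`. -/
def w10bar : ℕ → Bool := fun n => decide (n = 0)
/-- The word `0 1̄ = 0111⋯`. -/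
def w01bar : ℕ → Bool := fun n => decide (n ≠ 0)
/-- The word `01 0̄ = 01000⋯`. -/
def w010bar : ℕ → Bool := fun n => decide (n = 1)
/-- The word `10 1̄ = 10111⋯`. -/
def w101bar : ℕ → Bool := fun n => decide (n ≠ 1)
/-- The word `0̄`. -/
def w0bar : ℕ → Bool := fun _ => false
/-- The word `1̄`. -/
def w1bar : ℕ → Bool := fun _ => true

/-- Prepend a letter to an infinite word. -/
def consB (b : Bool) (u : ℕ → Bool) : ℕ → Bool := fun n =>
  match n with
  | 0 => b
  | Nat.succ k => u k

/-- Prepend a finite word to an infinite word. -/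
def appendW (w : List Bool) (v : ℕ → Bool) : ℕ → Bool := fun n =>
  if n < w.length then w.getD n false else v (n - w.length)

/-- The suffix `u_{k+1}u_{k+2}⋯` of `u` (letters numbered from `1`). -/
def shiftBy (k : ℕ) (u : ℕ → Bool) : ℕ → Bool := fun i => u (i + k)

theorem shiftBy_add (k l : ℕ) (u : ℕ → Bool) :
    shiftBy k (shiftBy l u) = shiftBy (k + l) u := by
  funext i
  simp [shiftBy, add_assoc]

theorem shiftBy_mem_orbit (k : ℕ) (u : ℕ → Bool) : shiftBy k u ∈ orbit u := ⟨k, rfl⟩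

theorem orbit1_subset_orbit (u : ℕ → Bool) : orbit1 u ⊆ orbit u := by
  rintro _ ⟨k, -, rfl⟩
  exact ⟨k + 1, rfl⟩

/-! ### Concatenation of a finite and an infinite word -/

@[simp] theorem appendW_nil (v : ℕ → Bool) : appendW [] v = v := by
  funext n
  simp [appendW]

@[simp] theorem appendW_cons_zero (b : Bool) (w : List Bool) (v : ℕ → Bool) :
    appendW (b :: w) v 0 = b := by
  simp [appendW]

@[simp] theorem appendW_cons_succ (b : Bool) (w : List Bool) (v : ℕ → Bool) (n : ℕ) :
    appendW (b :: w) v (n + 1) = appendW w v n := by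
  simp [appendW]

theorem shiftBy_one_appendW_cons (b : Bool) (w : List Bool) (v : ℕ → Bool) :
    shiftBy 1 (appendW (b :: w) v) = appendW w v := by
  funext n
  simp [shiftBy]

theorem appendW_append (w₁ w₂ : List Bool) (v : ℕ → Bool) :
    appendW (w₁ ++ w₂) v = appendW w₁ (appendW w₂ v) := by
  induction w₁ with
  | nil => simp
  | cons b w₁ ih =>
    funext n
    cases n <;> simp [ih]

theorem appendW_cons (b : Bool) (w : List Bool) (v : ℕ → Bool) :
    appendW (b :: w) v = appendW [b] (appendW w v) :=
  appendW_append [b] w v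

theorem shiftBy_length_appendW (w : List Bool) (v : ℕ → Bool) :
    shiftBy w.length (appendW w v) = v := by
  funext n
  simp [shiftBy, appendW]

theorem appendW_head_tail (u : ℕ → Bool) : appendW [u 0] (shiftBy 1 u) = u := by
  funext n
  cases n <;> simp [shiftBy]

theorem appendW_congr {w : List Bool} {v v' : ℕ → Bool} {n : ℕ}
    (h : ∀ i, i < n - w.length → v i = v' i) :
    ∀ i, i < n → appendW w v i = appendW w v' i := by
  intro i hi
  by_cases hw : i < w.length
  · simp [appendW, hw]
  · simpa [appendW, hw] using h (i - w.length) (by omega)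

/-! ### The lexicographic order -/

theorem lexLt_of_head {x y : ℕ → Bool} (hx : x 0 = false) (hy : y 0 = true) : lexLt x y :=
  ⟨0, by simp, by simp [hx, hy]⟩

theorem lexLt.appendW {x y : ℕ → Bool} (h : lexLt x y) (w : List Bool) :
    lexLt (appendW w x) (appendW w y) := by
  obtain ⟨n, hn, hlt⟩ := h
  refine ⟨n + w.length, appendW_congr (by simpa using hn), by simpa [_root_.appendW] using hlt⟩

theorem lexLe.appendW {x y : ℕ → Bool} (h : lexLe x y) (w : List Bool) :
    lexLe (appendW w x) (appendW w y) := by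
  rcases h with h | rfl
  · exact Or.inl (h.appendW w)
  · exact Or.inr rfl

theorem lexLe.head_eq_false {x y : ℕ → Bool} (h : lexLe x y) (hy : y 0 = false) :
    x 0 = false := by
  rcases h with ⟨n, hn, hlt⟩ | rfl
  · rcases n with _ | n
    · simp [hy, Bool.lt_iff] at hlt
    · rw [hn 0 (by omega), hy]
  · exact hy

theorem lexLe_iff {x y : ℕ → Bool} :
    lexLe x y ↔ ∀ n, (∀ i, i < n → y i = x i) → y n = false → x n = false := by
  constructor
  · rintro (⟨n, hn, hlt⟩ | rfl) m hm hy
    · rcases lt_trichotomy m n with h | rfl | h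
      · rw [hn m h, hy]
      · simp [hy, Bool.lt_iff] at hlt
      · simp [hm n h] at hlt
    · exact hy
  · intro h
    by_cases hxy : x = y
    · exact Or.inr hxy
    · have hex : ∃ n, x n ≠ y n := by
        by_contra! hc
        exact hxy (funext hc)
      classical
      have hmin : ∀ i, i < Nat.find hex → x i = y i := fun i hi => by
        simpa using Nat.find_min hex hi
      refine Or.inl ⟨Nat.find hex, hmin, ?_⟩
      have hne := Nat.find_spec hex
      have hle := h (Nat.find hex) fun i hi => (hmin i hi).symm
      revert hne hle
      cases x (Nat.find hex) <;> cases y (Nat.find hex) <;> simp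

/-! ### The greedy infimum -/

theorem lexInfSeq_eq_of_approx {S : Set (ℕ → Bool)} {x : ℕ → Bool}
    (hle : ∀ s ∈ S, lexLe x s) (happ : ∀ n, ∃ s ∈ S, ∀ i, i < n → s i = x i) :
    lexInfSeq S = x := by
  funext n
  induction n using Nat.strong_induction_on with
  | _ n ih =>
    have hiff : (∃ s ∈ S, (∀ i, i < n → s i = lexInfSeq S i) ∧ s n = false) ↔ x n = false := by
      constructor
      · rintro ⟨s, hs, hi, hn⟩
        exact lexLe_iff.1 (hle s hs) n (fun i h => (hi i h).trans (ih i h)) hn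
      · intro hx
        obtain ⟨s, hs, hi⟩ := happ (n + 1)
        exact ⟨s, hs, fun i h => (hi i (by omega)).trans (ih i h).symm,
          (hi n (by omega)).trans hx⟩
    rw [lexInfSeq, hiff]
    cases x n <;> simp

theorem lexInfSeq_le {S : Set (ℕ → Bool)} {s : ℕ → Bool} (hs : s ∈ S) :
    lexLe (lexInfSeq S) s := by
  rw [lexLe_iff]
  intro n hi hn
  rw [lexInfSeq]
  simpa using ⟨s, hs, hi, hn⟩

theorem lexInfSeq_approx {S : Set (ℕ → Bool)} (hS : S.Nonempty) (n : ℕ) :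
    ∃ s ∈ S, ∀ i, i < n → s i = lexInfSeq S i := by
  induction n with
  | zero =>
    obtain ⟨s, hs⟩ := hS
    exact ⟨s, hs, by simp⟩
  | succ n ih =>
    by_cases h : ∃ s ∈ S, (∀ i, i < n → s i = lexInfSeq S i) ∧ s n = false
    · obtain ⟨s, hs, hi, hn⟩ := h
      refine ⟨s, hs, fun i hlt => ?_⟩
      rcases Nat.lt_succ_iff_lt_or_eq.1 hlt with hlt | rfl
      · exact hi i hlt
      · rw [hn, lexInfSeq]
        simpa using ⟨s, hs, hi, hn⟩
    · obtain ⟨s, hs, hi⟩ := ih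
      refine ⟨s, hs, fun i hlt => ?_⟩
      rcases Nat.lt_succ_iff_lt_or_eq.1 hlt with hlt | rfl
      · exact hi i hlt
      · have hsi : s i = true := by
          by_contra hc
          exact h ⟨s, hs, hi, by simpa using hc⟩
        rw [hsi, lexInfSeq]
        simpa using h

/-- `x` is the common value of `inf O(u)` and `inf₁(u)`: it bounds `O(u)` from below and is
approximated by suffixes of `u` that are preceded by `1`. -/
def IsCommonInf (u x : ℕ → Bool) : Prop :=
  (∀ s ∈ orbit u, lexLe x s) ∧ ∀ n, ∃ s ∈ orbit1 u, ∀ i, i < n → s i = x i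

theorem IsCommonInf.infO_eq {u x : ℕ → Bool} (h : IsCommonInf u x) : infO u = x :=
  lexInfSeq_eq_of_approx h.1 fun n =>
    let ⟨s, hs, hi⟩ := h.2 n
    ⟨s, orbit1_subset_orbit u hs, hi⟩

theorem IsCommonInf.inf1_eq {u x : ℕ → Bool} (h : IsCommonInf u x) : inf1 u = x :=
  lexInfSeq_eq_of_approx (fun s hs => h.1 s (orbit1_subset_orbit u hs)) h.2

theorem orbit1_nonempty_of_infO_eq_inf1 {u : ℕ → Bool} (h : infO u = inf1 u) :
    (orbit1 u).Nonempty := by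
  by_contra hne
  rw [Set.not_nonempty_iff_eq_empty] at hne
  have h1 : inf1 u 0 = true := by
    rw [inf1, hne, lexInfSeq]
    simp
  have hu : u 0 = true := by
    by_contra hc
    have hinf := (lexInfSeq_le (shiftBy_mem_orbit 0 u)).head_eq_false (by simpa [shiftBy] using hc)
    rw [← infO, h, h1] at hinf
    cases hinf
  have hmem : shiftBy 1 u ∈ orbit1 u := ⟨0, hu, rfl⟩
  simp [hne] at hmem

theorem isCommonInf_infO {u : ℕ → Bool} (h : infO u = inf1 u) : IsCommonInf u (infO u) := by
  refine ⟨fun s hs => lexInfSeq_le hs, fun n => ?_⟩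
  rw [h]
  exact lexInfSeq_approx (orbit1_nonempty_of_infO_eq_inf1 h) n

/-! ### Substitutions on infinite words -/

/-- A substitution is nonerasing if no letter has an empty image. -/
def Nonerasing (σ : Bool → List Bool) : Prop := ∀ b, 0 < (σ b).length

theorem strictMono_sum_length {σ : Bool → List Bool} (hσ : Nonerasing σ) (u : ℕ → Bool) :
    StrictMono fun k => ∑ i ∈ Finset.range k, (σ (u i)).length :=
  strictMono_nat_of_lt_succ fun k => by
    simpa [Finset.sum_range_succ] using hσ (u k)

theorem substApply_eq_getD {σ : Bool → List Bool} (hσ : Nonerasing σ) {u : ℕ → Bool} {n k : ℕ}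
    (hk : ∑ i ∈ Finset.range k, (σ (u i)).length ≤ n)
    (hk' : n < ∑ i ∈ Finset.range (k + 1), (σ (u i)).length) :
    substApply σ u n = (σ (u k)).getD (n - ∑ i ∈ Finset.range k, (σ (u i)).length) false := by
  have hmono := strictMono_sum_length hσ u
  have hsup : sSup {k : ℕ | ∑ i ∈ Finset.range k, (σ (u i)).length ≤ n} = k :=
    IsGreatest.csSup_eq ⟨hk, fun l hl =>
      Nat.lt_succ_iff.1 (hmono.lt_iff_lt.1 (lt_of_le_of_lt hl hk'))⟩
  simp only [substApply, hsup]

theorem exists_sum_length_le_lt {σ : Bool → List Bool} (hσ : Nonerasing σ) (u : ℕ → Bool)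
    (n : ℕ) : ∃ k, ∑ i ∈ Finset.range k, (σ (u i)).length ≤ n ∧
      n < ∑ i ∈ Finset.range (k + 1), (σ (u i)).length := by
  induction n with
  | zero => exact ⟨0, by simp, by simpa using hσ (u 0)⟩
  | succ n ih =>
    obtain ⟨k, hk, hk'⟩ := ih
    rcases Nat.lt_or_ge (n + 1) (∑ i ∈ Finset.range (k + 1), (σ (u i)).length) with h | h
    · exact ⟨k, by omega, h⟩
    · refine ⟨k + 1, h, ?_⟩
      rw [Finset.sum_range_succ _ (k + 1)]
      have := hσ (u (k + 1))
      omega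

theorem substApply_eq_appendW {σ : Bool → List Bool} (hσ : Nonerasing σ) (u : ℕ → Bool) :
    substApply σ u = appendW (σ (u 0)) (substApply σ (shiftBy 1 u)) := by
  funext n
  by_cases hn : n < (σ (u 0)).length
  · rw [substApply_eq_getD hσ (k := 0) (by simp) (by simpa using hn)]
    simp [appendW, hn]
  · obtain ⟨k, hk, hk'⟩ := exists_sum_length_le_lt hσ (shiftBy 1 u) (n - (σ (u 0)).length)
    have hsum : ∀ l, ∑ i ∈ Finset.range (l + 1), (σ (u i)).length =
        ∑ i ∈ Finset.range l, (σ (shiftBy 1 u i)).length + (σ (u 0)).length := fun l =>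
      Finset.sum_range_succ' _ l
    have hs := hsum k
    have hs' := hsum (k + 1)
    rw [substApply_eq_getD hσ (k := k + 1) (by omega) (by omega)]
    simp only [appendW, hn, if_false]
    rw [substApply_eq_getD hσ hk hk', hs]
    simp only [shiftBy]
    congr 1
    omega

theorem substApply_appendW {σ : Bool → List Bool} (hσ : Nonerasing σ) (w : List Bool)
    (v : ℕ → Bool) : substApply σ (appendW w v) = appendW (w.flatMap σ) (substApply σ v) := by
  induction w with
  | nil => simp
  | cons b w ih =>
    rw [substApply_eq_appendW hσ, appendW_cons_zero, shiftBy_one_appendW_cons, ih,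
      List.flatMap_cons, appendW_append]

theorem substApply_congr {σ : Bool → List Bool} (hσ : Nonerasing σ) {n : ℕ} {u v : ℕ → Bool}
    (h : ∀ i, i < n → u i = v i) : ∀ i, i < n → substApply σ u i = substApply σ v i := by
  induction n generalizing u v with
  | zero => simp
  | succ n ih =>
    rw [substApply_eq_appendW hσ u, substApply_eq_appendW hσ v, h 0 (by omega)]
    have hpos := hσ (v 0)
    refine appendW_congr fun i hi => ?_
    exact ih (u := shiftBy 1 u) (v := shiftBy 1 v) (fun j hj => h (j + 1) (by omega)) i (by omega)

theorem substApply_unique {σ : Bool → List Bool} (hσ : Nonerasing σ)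
    {F : (ℕ → Bool) → ℕ → Bool} (hF : ∀ u, F u = appendW (σ (u 0)) (F (shiftBy 1 u)))
    (u : ℕ → Bool) : F u = substApply σ u := by
  have key : ∀ n u, ∀ i, i < n → F u i = substApply σ u i := by
    intro n
    induction n with
    | zero => simp
    | succ n ih =>
      intro u
      rw [hF u, substApply_eq_appendW hσ u]
      have hpos := hσ (u 0)
      exact appendW_congr fun i hi => ih _ i (by omega)
  exact funext fun i => key (i + 1) u i (by omega)

theorem Nonerasing.idSub : Nonerasing idSub := fun b => by simp [_root_.idSub]

theorem Nonerasing.compSub {σ τ : Bool → List Bool} (hσ : Nonerasing σ) (hτ : Nonerasing τ) :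
    Nonerasing (compSub σ τ) := by
  intro b
  obtain ⟨a, ha⟩ := List.exists_mem_of_length_pos (hτ b)
  obtain ⟨c, hc⟩ := List.exists_mem_of_length_pos (hσ a)
  exact List.length_pos_of_mem (List.mem_flatMap.2 ⟨a, ha, hc⟩)

theorem substApply_compSub {σ τ : Bool → List Bool} (hσ : Nonerasing σ) (hτ : Nonerasing τ)
    (u : ℕ → Bool) : substApply (compSub σ τ) u = substApply σ (substApply τ u) :=
  (substApply_unique (hσ.compSub hτ) (F := fun u => substApply σ (substApply τ u))
    (fun u => by
      rw [substApply_eq_appendW hτ u, substApply_appendW hσ]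
      rfl) u).symm

theorem substApply_idSub (u : ℕ → Bool) : substApply idSub u = u :=
  (substApply_unique Nonerasing.idSub (F := fun u => u)
    (fun u => (appendW_head_tail u).symm) u).symm

theorem exists_suffix_of_mem_orbit_substApply {σ : Bool → List Bool} (hσ : Nonerasing σ)
    {u v : ℕ → Bool} (hv : v ∈ orbit (substApply σ u)) :
    ∃ k w, w ≠ [] ∧ w <:+ σ (u k) ∧ v = appendW w (substApply σ (shiftBy (k + 1) u)) := by
  obtain ⟨n, rfl⟩ := hv
  have hne : ∀ b, σ b ≠ [] := fun b => List.ne_nil_of_length_pos (hσ b)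
  change ∃ k w, w ≠ [] ∧ w <:+ σ (u k) ∧
    shiftBy n (substApply σ u) = appendW w (substApply σ (shiftBy (k + 1) u))
  induction n with
  | zero => exact ⟨0, σ (u 0), hne _, List.suffix_rfl, substApply_eq_appendW hσ u⟩
  | succ n ih =>
    obtain ⟨k, w, hw, hsuf, heq⟩ := ih
    rw [Nat.add_comm, ← shiftBy_add, heq]
    obtain ⟨b, w, rfl⟩ := List.exists_cons_of_ne_nil hw
    rw [shiftBy_one_appendW_cons]
    rcases eq_or_ne w [] with rfl | hw'
    · refine ⟨k + 1, σ (u (k + 1)), hne _, List.suffix_rfl, ?_⟩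
      rw [appendW_nil, substApply_eq_appendW hσ, shiftBy_add, Nat.add_comm 1]
      simp [shiftBy]
    · exact ⟨k, w, hw', (List.suffix_cons b w).trans hsuf, rfl⟩

theorem exists_shiftBy_substApply {σ : Bool → List Bool} (hσ : Nonerasing σ) (u : ℕ → Bool)
    (k : ℕ) : ∃ n, shiftBy n (substApply σ u) = substApply σ (shiftBy k u) := by
  induction k with
  | zero => exact ⟨0, rfl⟩
  | succ k ih =>
    obtain ⟨n, hn⟩ := ih
    refine ⟨(σ (u k)).length + n, ?_⟩
    rw [← shiftBy_add, hn, substApply_eq_appendW hσ, shiftBy_add, Nat.add_comm 1]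
    simpa [shiftBy] using shiftBy_length_appendW (σ (u k)) (substApply σ (shiftBy (k + 1) u))

theorem appendW_substApply_mem_orbit1 {σ : Bool → List Bool} (hσ : Nonerasing σ)
    {u : ℕ → Bool} {k : ℕ} {p w : List Bool} (h : σ (u k) = p ++ true :: w) :
    appendW w (substApply σ (shiftBy (k + 1) u)) ∈ orbit1 (substApply σ u) := by
  obtain ⟨n, hn⟩ := exists_shiftBy_substApply hσ u k
  set v := appendW (true :: w) (substApply σ (shiftBy (k + 1) u)) with hv
  have hpv : shiftBy (p.length + n) (substApply σ u) = v := by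
    rw [← shiftBy_add, hn, substApply_eq_appendW hσ, shiftBy_add, Nat.add_comm 1]
    simp only [shiftBy, Nat.zero_add, h, appendW_append]
    exact shiftBy_length_appendW p v
  refine ⟨p.length + n, ?_, ?_⟩
  · simpa [shiftBy, hv] using congrFun hpv 0
  · rw [← shiftBy_one_appendW_cons true w, ← hv, ← hpv, shiftBy_add]
    funext i
    simp only [shiftBy]
    congr 1
    omega

theorem lexLt_substApply {σ : Bool → List Bool} (hσ : Nonerasing σ)
    (hlt : ∀ a b, lexLt (appendW (σ false) (substApply σ a)) (appendW (σ true) (substApply σ b)))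
    {x y : ℕ → Bool} (h : lexLt x y) : lexLt (substApply σ x) (substApply σ y) := by
  obtain ⟨n, hn, hxy⟩ := h
  rw [Bool.lt_iff] at hxy
  induction n generalizing x y with
  | zero =>
    rw [substApply_eq_appendW hσ x, substApply_eq_appendW hσ y, hxy.1, hxy.2]
    exact hlt _ _
  | succ n ih =>
    rw [substApply_eq_appendW hσ x, substApply_eq_appendW hσ y, hn 0 (by omega)]
    exact (ih (x := shiftBy 1 x) (y := shiftBy 1 y) (fun i hi => hn (i + 1) (by omega))
      hxy).appendW _

theorem lexLe_substApply {σ : Bool → List Bool} (hσ : Nonerasing σ)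
    (hlt : ∀ a b, lexLt (appendW (σ false) (substApply σ a)) (appendW (σ true) (substApply σ b)))
    {x y : ℕ → Bool} (h : lexLe x y) : lexLe (substApply σ x) (substApply σ y) := by
  rcases h with h | rfl
  · exact Or.inl (lexLt_substApply hσ hlt h)
  · exact Or.inr rfl

/-- The pair `(σ, w)` transports common infima: `w` is a suffix of `σ(1)` preceded by `1`, and
`x ↦ w·σ(x)` maps the common infimum of `u` to that of `σ(u)`. -/
structure TransportsInf (σ : Bool → List Bool) (w : List Bool) : Prop where
  nonerasing : Nonerasing σ
  exists_image_one : ∃ p, σ true = p ++ true :: w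
  isCommonInf : ∀ {u x : ℕ → Bool}, IsCommonInf u x →
    IsCommonInf (substApply σ u) (appendW w (substApply σ x))

theorem TransportsInf.of_lower_bound {σ : Bool → List Bool} {w p : List Bool}
    (hσ : Nonerasing σ) (hp : σ true = p ++ true :: w)
    (hle : ∀ x s : ℕ → Bool, lexLe x s → lexLe x (shiftBy 1 s) → ∀ v, v ≠ [] → v <:+ σ (s 0) →
      lexLe (appendW w (substApply σ x)) (appendW v (substApply σ (shiftBy 1 s)))) :
    TransportsInf σ w := by
  refine ⟨hσ, ⟨p, hp⟩, fun {u x} h => ⟨fun s hs => ?_, fun n => ?_⟩⟩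
  · obtain ⟨k, v, hv, hsuf, rfl⟩ := exists_suffix_of_mem_orbit_substApply hσ hs
    have := hle x (shiftBy k u) (h.1 _ (shiftBy_mem_orbit k u))
    rw [shiftBy_add, Nat.add_comm 1] at this
    exact this (h.1 _ (shiftBy_mem_orbit (k + 1) u)) v hv (by simpa [shiftBy] using hsuf)
  · obtain ⟨s, ⟨k, hk, rfl⟩, hi⟩ := h.2 n
    refine ⟨_, appendW_substApply_mem_orbit1 hσ (k := k) (by rw [hk, hp]), ?_⟩
    exact appendW_congr fun i hlt =>
      substApply_congr hσ (n := n) (u := shiftBy (k + 1) u) hi i (by omega)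

theorem TransportsInf.idSub : TransportsInf idSub [] :=
  ⟨Nonerasing.idSub, ⟨[], rfl⟩, fun {u x} h => by simpa [substApply_idSub] using h⟩

theorem TransportsInf.compSub {σ τ : Bool → List Bool} {w v : List Bool}
    (hσ : TransportsInf σ w) (hτ : TransportsInf τ v) :
    TransportsInf (compSub σ τ) (w ++ v.flatMap σ) := by
  refine ⟨hσ.nonerasing.compSub hτ.nonerasing, ?_, fun {u x} h => ?_⟩
  · obtain ⟨p, hp⟩ := hσ.exists_image_one
    obtain ⟨q, hq⟩ := hτ.exists_image_one
    exact ⟨q.flatMap σ ++ p, by simp [_root_.compSub, hp, hq]⟩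
  · rw [substApply_compSub hσ.nonerasing hτ.nonerasing,
      substApply_compSub hσ.nonerasing hτ.nonerasing, appendW_append,
      ← substApply_appendW hσ.nonerasing]
    exact hσ.isCommonInf (hτ.isCommonInf h)

/-! ### The substitutions `L`, `M`, `R` -/

theorem nonerasing_Lsub : Nonerasing Lsub := by
  intro b
  cases b <;> simp [Lsub]

theorem nonerasing_Msub : Nonerasing Msub := by
  intro b
  cases b <;> simp [Msub]

theorem nonerasing_Rsub : Nonerasing Rsub := by
  intro b
  cases b <;> simp [Rsub]

theorem substApply_Lsub_zero (u : ℕ → Bool) : substApply Lsub u 0 = false := by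
  rw [substApply_eq_appendW nonerasing_Lsub]
  cases u 0 <;> simp [Lsub]

theorem substApply_Msub_zero (u : ℕ → Bool) : substApply Msub u 0 = u 0 := by
  rw [substApply_eq_appendW nonerasing_Msub]
  cases u 0 <;> simp [Msub]

theorem substApply_Rsub_zero (u : ℕ → Bool) : substApply Rsub u 0 = u 0 := by
  rw [substApply_eq_appendW nonerasing_Rsub]
  cases u 0 <;> simp [Rsub]

theorem lexLe_substApply_Lsub {x y : ℕ → Bool} (h : lexLe x y) :
    lexLe (substApply Lsub x) (substApply Lsub y) := by
  refine lexLe_substApply nonerasing_Lsub (fun a b => ?_) h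
  have hlt := lexLt_of_head (substApply_Lsub_zero a)
    (appendW_cons_zero true [] (substApply Lsub b))
  simpa [Lsub, ← appendW_append] using hlt.appendW [false]

theorem lexLe_substApply_Msub {x y : ℕ → Bool} (h : lexLe x y) :
    lexLe (substApply Msub x) (substApply Msub y) :=
  lexLe_substApply nonerasing_Msub (fun a b => lexLt_of_head (by simp [Msub]) (by simp [Msub])) h

theorem lexLe_substApply_Rsub {x y : ℕ → Bool} (h : lexLe x y) :
    lexLe (substApply Rsub x) (substApply Rsub y) :=
  lexLe_substApply nonerasing_Rsub (fun a b => lexLt_of_head (by simp [Rsub]) (by simp [Rsub])) h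

theorem transportsInf_Lsub : TransportsInf Lsub [] := by
  refine .of_lower_bound nonerasing_Lsub (p := [false]) rfl fun x s hxs _ v hv hsuf => ?_
  rw [appendW_nil]
  by_cases hfull : v = Lsub (s 0)
  · rw [hfull, ← substApply_eq_appendW nonerasing_Lsub]
    exact lexLe_substApply_Lsub hxs
  · obtain rfl : v = [true] := by
      cases hs : s 0 <;> simp_all [Lsub, List.suffix_cons_iff]
    exact Or.inl (lexLt_of_head (substApply_Lsub_zero x) (appendW_cons_zero _ _ _))

theorem transportsInf_Rsub : TransportsInf Rsub [] := by
  refine .of_lower_bound nonerasing_Rsub (p := []) rfl fun x s hxs _ v hv hsuf => ?_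
  rw [appendW_nil]
  by_cases hfull : v = Rsub (s 0)
  · rw [hfull, ← substApply_eq_appendW nonerasing_Rsub]
    exact lexLe_substApply_Rsub hxs
  · obtain ⟨hs, rfl⟩ : s 0 = false ∧ v = [true] := by
      cases hs : s 0 <;> simp_all [Rsub, List.suffix_cons_iff]
    refine Or.inl (lexLt_of_head ?_ (appendW_cons_zero _ _ _))
    rw [substApply_Rsub_zero, hxs.head_eq_false hs]

theorem transportsInf_Msub : TransportsInf Msub [false] := by
  refine .of_lower_bound nonerasing_Msub (p := []) rfl fun x s hxs hxs' v hv hsuf => ?_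
  have hcases : v = [true] ∨ v = [true, false] ∨ v = [false] ∨
      (s 0 = false ∧ v = [false, true]) := by
    cases hs : s 0 <;> simp_all [Msub, List.suffix_cons_iff]
    tauto
  rcases hcases with rfl | rfl | rfl | ⟨hs, rfl⟩
  · exact Or.inl (lexLt_of_head (appendW_cons_zero _ _ _) (appendW_cons_zero _ _ _))
  · exact Or.inl (lexLt_of_head (appendW_cons_zero _ _ _) (appendW_cons_zero _ _ _))
  · exact (lexLe_substApply_Msub hxs').appendW [false]
  · rw [appendW_cons false [true]]
    refine Or.inl ((lexLt_of_head ?_ (appendW_cons_zero _ _ _)).appendW [false])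
    rw [substApply_Msub_zero, hxs.head_eq_false hs]

theorem exists_transportsInf_of_mem_LMRstar {σ : Bool → List Bool} (hσ : σ ∈ LMRstar) :
    ∃ w, TransportsInf σ w := by
  obtain ⟨l, hl, rfl⟩ := hσ
  induction l with
  | nil => exact ⟨[], .idSub⟩
  | cons τ l ih =>
    obtain ⟨v, hv⟩ := ih fun τ' hτ' => hl τ' (List.mem_cons_of_mem _ hτ')
    rcases hl τ List.mem_cons_self with rfl | rfl | rfl
    · exact ⟨_, transportsInf_Lsub.compSub hv⟩
    · exact ⟨_, transportsInf_Msub.compSub hv⟩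
    · exact ⟨_, transportsInf_Rsub.compSub hv⟩

/-- For each `σ ∈ {L,M,R}*` there is a suffix `w` of `σ(1)` with
`inf₁(σ(u)) = inf O(σ(u)) = w·σ(inf O(u))` whenever `inf O(u) = inf₁(u)`. -/
theorem inf_subst_suffix (σ : Bool → List Bool) (hσ : σ ∈ LMRstar) :
    ∃ w : List Bool, w <:+ σ true ∧
      ∀ u : ℕ → Bool, infO u = inf1 u →
        inf1 (substApply σ u) = infO (substApply σ u) ∧
        infO (substApply σ u) = appendW w (substApply σ (infO u)) := by
  obtain ⟨w, hw⟩ := exists_transportsInf_of_mem_LMRstar hσ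
  obtain ⟨p, hp⟩ := hw.exists_image_one
  refine ⟨w, ⟨p ++ [true], by simp [hp]⟩, fun u hu => ?_⟩
  have h := hw.isCommonInf (isCommonInf_infO hu)
  exact ⟨h.inf1_eq.trans h.infO_eq.symm, h.infO_eq⟩
end

section
/- Let u ∈ {0,1}^ℕ be such that u ≠ 0^k 1̄ and u ≠ 1^k 0̄ for all k ≥ 0 (i.e. u is not a finite block of zeros followed by all ones, nor a finite block of ones followed by all zeros). Then there exists a suffix v of u (i.e. v = u_k u_{k+1}⋯ for some k ≥ 1) such that inf O(v) = inf₁(v) = inf₁(u) and sup O(v) = sup₀(v) = sup₀(u). -/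
/-- The suffix of `u` starting at position `k`, in the lexicographic order. -/
def lexSuffix (u : ℕ → Bool) (k : ℕ) : Lex (ℕ → Bool) := toLex fun i => u (i + k)

open Classical in
theorem isGLB_lexInfSeq (S : Set (ℕ → Bool)) :
    IsGLB {x : Lex (ℕ → Bool) | ofLex x ∈ S} (toLex (lexInfSeq S)) := by
  constructor
  · intro s hs
    by_contra hlt
    obtain ⟨n, hn, hsn⟩ := not_le.mp hlt
    change ∀ i, i < n → ofLex s i = lexInfSeq S i at hn
    change ofLex s n < lexInfSeq S n at hsn
    obtain ⟨hsn, hinf⟩ := Bool.lt_iff.mp hsn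
    rw [lexInfSeq, decide_eq_true_eq] at hinf
    exact hinf ⟨ofLex s, hs, hn, hsn⟩
  · intro b hb
    by_contra hlt
    obtain ⟨n, hn, hbn⟩ := not_le.mp hlt
    change ∀ i, i < n → lexInfSeq S i = ofLex b i at hn
    change lexInfSeq S n < ofLex b n at hbn
    obtain ⟨hinf, hbn⟩ := Bool.lt_iff.mp hbn
    rw [lexInfSeq, decide_eq_false_iff_not, not_not] at hinf
    obtain ⟨s, hs, hagree, hsn⟩ := hinf
    refine (hb (show ofLex (toLex s) ∈ S from hs)).not_gt
      ⟨n, fun i hi => (hagree i hi).trans (hn i hi), ?_⟩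
    exact Bool.lt_iff.mpr ⟨hsn, hbn⟩

open Classical in
theorem isLUB_lexSupSeq (S : Set (ℕ → Bool)) :
    IsLUB {x : Lex (ℕ → Bool) | ofLex x ∈ S} (toLex (lexSupSeq S)) := by
  constructor
  · intro s hs
    by_contra hlt
    obtain ⟨n, hn, hsn⟩ := not_le.mp hlt
    change ∀ i, i < n → lexSupSeq S i = ofLex s i at hn
    change lexSupSeq S n < ofLex s n at hsn
    obtain ⟨hsup, hsn⟩ := Bool.lt_iff.mp hsn
    rw [lexSupSeq, decide_eq_false_iff_not] at hsup
    exact hsup ⟨ofLex s, hs, fun i hi => (hn i hi).symm, hsn⟩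
  · intro b hb
    by_contra hlt
    obtain ⟨n, hn, hbn⟩ := not_le.mp hlt
    change ∀ i, i < n → ofLex b i = lexSupSeq S i at hn
    change ofLex b n < lexSupSeq S n at hbn
    obtain ⟨hbn, hsup⟩ := Bool.lt_iff.mp hbn
    rw [lexSupSeq, decide_eq_true_eq] at hsup
    obtain ⟨s, hs, hagree, hsn⟩ := hsup
    refine (hb (show ofLex (toLex s) ∈ S from hs)).not_gt
      ⟨n, fun i hi => (hn i hi).trans (hagree i hi).symm, ?_⟩
    exact Bool.lt_iff.mpr ⟨hbn, hsn⟩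

theorem le_inf1_iff (u : ℕ → Bool) (j : ℕ) (b : Lex (ℕ → Bool)) :
    b ≤ toLex (inf1 fun i => u (i + j)) ↔
      ∀ k, j ≤ k → u k = true → b ≤ lexSuffix u (k + 1) := by
  rw [inf1, le_isGLB_iff (isGLB_lexInfSeq _)]
  constructor
  · intro h k hjk hk
    refine h ⟨k - j, ?_, ?_⟩
    · simpa [Nat.sub_add_cancel hjk] using hk
    · funext i
      change u (i + (k + 1)) = u (i + (k - j) + 1 + j)
      congr 1
      omega
  · rintro h x ⟨k, hk, hx⟩
    have hx' : x = lexSuffix u (k + j + 1) := by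
      refine hx.trans (funext fun i => ?_)
      change u (i + k + 1 + j) = u (i + (k + j + 1))
      congr 1
      omega
    rw [hx']
    exact h _ (by omega) hk

theorem sup0_le_iff (u : ℕ → Bool) (j : ℕ) (b : Lex (ℕ → Bool)) :
    toLex (sup0 fun i => u (i + j)) ≤ b ↔
      ∀ k, j ≤ k → u k = false → lexSuffix u (k + 1) ≤ b := by
  rw [sup0, isLUB_le_iff (isLUB_lexSupSeq _)]
  constructor
  · intro h k hjk hk
    refine h ⟨k - j, ?_, ?_⟩
    · simpa [Nat.sub_add_cancel hjk] using hk
    · funext i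
      change u (i + (k + 1)) = u (i + (k - j) + 1 + j)
      congr 1
      omega
  · rintro h x ⟨k, hk, hx⟩
    have hx' : x = lexSuffix u (k + j + 1) := by
      refine hx.trans (funext fun i => ?_)
      change u (i + k + 1 + j) = u (i + (k + j + 1))
      congr 1
      omega
    rw [hx']
    exact h _ (by omega) hk

theorem le_infO_iff (v : ℕ → Bool) (b : Lex (ℕ → Bool)) :
    b ≤ toLex (infO v) ↔ ∀ k, b ≤ lexSuffix v k := by
  rw [infO, le_isGLB_iff (isGLB_lexInfSeq _)]
  constructor
  · exact fun h k => h ⟨k, rfl⟩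
  · rintro h x ⟨k, hx⟩
    exact (h k).trans_eq hx.symm

theorem supO_le_iff (v : ℕ → Bool) (b : Lex (ℕ → Bool)) :
    toLex (supO v) ≤ b ↔ ∀ k, lexSuffix v k ≤ b := by
  rw [supO, isLUB_le_iff (isLUB_lexSupSeq _)]
  constructor
  · exact fun h k => h ⟨k, rfl⟩
  · rintro h x ⟨k, hx⟩
    change x = lexSuffix v k at hx
    exact hx.le.trans (h k)

theorem lexSuffix_le_succ {u : ℕ → Bool} {k : ℕ} (hk : u k = false) :
    lexSuffix u k ≤ lexSuffix u (k + 1) := by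
  by_contra hlt
  obtain ⟨n, hn, hlt⟩ := not_le.mp hlt
  change ∀ i, i < n → u (i + (k + 1)) = u (i + k) at hn
  obtain ⟨-, hlt⟩ := Bool.lt_iff.mp hlt
  change u (n + k) = true at hlt
  have hzero : ∀ i, i ≤ n → u (i + k) = false := by
    intro i
    induction i with
    | zero => simpa using hk
    | succ i ih =>
      intro hi
      rw [show i + 1 + k = i + (k + 1) by omega, hn i (by omega)]
      exact ih (by omega)
  simp [hzero n le_rfl] at hlt

theorem lexSuffix_succ_le {u : ℕ → Bool} {k : ℕ} (hk : u k = true) :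
    lexSuffix u (k + 1) ≤ lexSuffix u k := by
  by_contra hlt
  obtain ⟨n, hn, hlt⟩ := not_le.mp hlt
  change ∀ i, i < n → u (i + k) = u (i + (k + 1)) at hn
  obtain ⟨hlt, -⟩ := Bool.lt_iff.mp hlt
  change u (n + k) = false at hlt
  have hone : ∀ i, i ≤ n → u (i + k) = true := by
    intro i
    induction i with
    | zero => simpa using hk
    | succ i ih =>
      intro hi
      rw [show i + 1 + k = i + (k + 1) by omega, ← hn i (by omega)]
      exact ih (by omega)
  simp [hone n le_rfl] at hlt

theorem lexSuffix_lt_of_head {u : ℕ → Bool} {k l : ℕ} (hk : u k = false) (hl : u l = true) :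
    lexSuffix u k < lexSuffix u l := by
  refine ⟨0, fun i hi => absurd hi (Nat.not_lt_zero i), Bool.lt_iff.mpr ⟨?_, ?_⟩⟩
  · change u (0 + k) = false
    simpa using hk
  · change u (0 + l) = true
    simpa using hl

theorem lexSuffix_succ_lt_of_head_eq {u : ℕ → Bool} {k l : ℕ} (hkl : u k = u l)
    (h : lexSuffix u k < lexSuffix u l) : lexSuffix u (k + 1) < lexSuffix u (l + 1) := by
  obtain ⟨n, hn, hlt⟩ := h
  change ∀ i, i < n → u (i + k) = u (i + l) at hn
  change u (n + k) < u (n + l) at hlt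
  cases n with
  | zero => simp [hkl] at hlt
  | succ n =>
    refine ⟨n, fun i hi => ?_, ?_⟩
    · change u (i + (k + 1)) = u (i + (l + 1))
      have := hn (i + 1) (by omega)
      rwa [Nat.add_right_comm, Nat.add_right_comm i 1 l] at this
    · change u (n + (k + 1)) < u (n + (l + 1))
      rwa [Nat.add_right_comm, Nat.add_right_comm n 1 l] at hlt

theorem infO_eq_inf1 {v : ℕ → Bool} (h : toLex (inf1 v) ≤ toLex v) : infO v = inf1 v := by
  refine toLex_inj.mp (le_antisymm ?_ ?_)
  · exact (le_inf1_iff v 0 _).mpr fun k _ _ => (le_infO_iff v _).mp le_rfl (k + 1)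
  · refine (le_infO_iff v _).mpr fun k => ?_
    induction k with
    | zero => exact h
    | succ k ih =>
      cases hk : v k with
      | false => exact ih.trans (lexSuffix_le_succ hk)
      | true => exact (le_inf1_iff v 0 _).mp le_rfl k (Nat.zero_le k) hk

theorem supO_eq_sup0 {v : ℕ → Bool} (h : toLex v ≤ toLex (sup0 v)) : supO v = sup0 v := by
  refine toLex_inj.mp (le_antisymm ?_ ?_)
  · refine (supO_le_iff v _).mpr fun k => ?_
    induction k with
    | zero => exact h
    | succ k ih =>
      cases hk : v k with
      | false => exact (sup0_le_iff v 0 _).mp le_rfl k (Nat.zero_le k) hk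
      | true => exact (lexSuffix_succ_le hk).trans ih
  · exact (sup0_le_iff v 0 _).mpr fun k _ _ => (supO_le_iff v _).mp le_rfl (k + 1)

theorem lexSuffix_mono_of_false {u : ℕ → Bool} {k m : ℕ} (hkm : k ≤ m)
    (hu : ∀ i, i < m → u i = false) : lexSuffix u k ≤ lexSuffix u m := by
  induction m, hkm using Nat.le_induction with
  | base => exact le_rfl
  | succ m _ ih =>
    exact (ih fun i hi => hu i (by omega)).trans (lexSuffix_le_succ (hu m (by omega)))

theorem inf1_suffix_eq {u : ℕ → Bool} {j : ℕ} (hu : ∀ i, i < j → u i = false) :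
    inf1 (fun i => u (i + j)) = inf1 u := by
  refine toLex_inj.mp (le_antisymm ?_ ?_)
  · refine (le_inf1_iff u 0 _).mpr fun k _ hk => ?_
    refine (le_inf1_iff u j _).mp le_rfl k ?_ hk
    by_contra hlt
    simp [hu k (by omega)] at hk
  · exact (le_inf1_iff u j _).mpr fun k _ hk =>
      (le_inf1_iff u 0 _).mp le_rfl k (Nat.zero_le k) hk

theorem sup0_suffix_eq {u : ℕ → Bool} {j : ℕ}
    (hu : ∀ i, i < j → lexSuffix u (i + 1) ≤ toLex (sup0 fun i => u (i + j))) :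
    sup0 (fun i => u (i + j)) = sup0 u := by
  refine toLex_inj.mp (le_antisymm ?_ ?_)
  · exact (sup0_le_iff u j _).mpr fun k _ hk =>
      (sup0_le_iff u 0 _).mp le_rfl k (Nat.zero_le k) hk
  · refine (sup0_le_iff u 0 _).mpr fun k _ hk => ?_
    by_cases hkj : k < j
    · exact hu k hkj
    · exact (sup0_le_iff u j _).mp le_rfl k (by omega) hk

/-- `j` starts a suffix of `u` with the same one-sided bounds as `u`, which bound its orbit. -/
def IsGoodSuffix (u : ℕ → Bool) (j : ℕ) : Prop :=
  infO (fun i => u (i + j)) = inf1 (fun i => u (i + j)) ∧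
  inf1 (fun i => u (i + j)) = inf1 u ∧
  supO (fun i => u (i + j)) = sup0 (fun i => u (i + j)) ∧
  sup0 (fun i => u (i + j)) = sup0 u

theorem exists_isGoodSuffix_of_head_false {u : ℕ → Bool} {k p : ℕ}
    (hu : ∀ i, i < k + 1 → u i = false) (hk : u (k + 1) = true)
    (hkp : k + 1 ≤ p) (hp : u p = true) (hp' : u (p + 1) = false) :
    ∃ j, IsGoodSuffix u j := by
  by_cases hle : toLex (inf1 u) ≤ lexSuffix u k
  · have hinf := inf1_suffix_eq (u := u) (j := k) fun i hi => hu i (by omega)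
    have hmem : lexSuffix u (k + 1) ≤ toLex (sup0 fun i => u (i + k)) :=
      (sup0_le_iff u k _).mp le_rfl k le_rfl (hu k (by omega))
    refine ⟨k, infO_eq_inf1 ?_, hinf, supO_eq_sup0 ?_, sup0_suffix_eq fun i hi => ?_⟩
    · rw [hinf]
      exact hle
    · exact (lexSuffix_le_succ (hu k (by omega))).trans hmem
    · exact (lexSuffix_mono_of_false (by omega) hu).trans hmem
  · have hinf := inf1_suffix_eq hu
    have hinf_le : toLex (inf1 u) ≤ lexSuffix u (p + 1) :=
      (le_inf1_iff u 0 _).mp le_rfl p (Nat.zero_le p) hp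
    have hlt : lexSuffix u (k + 1) < lexSuffix u (p + 1 + 1) :=
      lexSuffix_succ_lt_of_head_eq ((hu k (by omega)).trans hp'.symm)
        ((not_le.mp hle).trans_le hinf_le)
    have hmem : lexSuffix u (k + 1) ≤ toLex (sup0 fun i => u (i + (k + 1))) :=
      hlt.le.trans ((sup0_le_iff u (k + 1) _).mp le_rfl (p + 1) (by omega) hp')
    refine ⟨k + 1, infO_eq_inf1 ?_, hinf, supO_eq_sup0 hmem, sup0_suffix_eq fun i hi => ?_⟩
    · rw [hinf]
      exact hinf_le.trans (lexSuffix_lt_of_head hp' hk).le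
    · exact (lexSuffix_mono_of_false (by omega) hu).trans hmem

theorem exists_isGoodSuffix_of_zero_false {u : ℕ → Bool} (h0 : u 0 = false)
    (h01 : ∀ k : ℕ, u ≠ fun n => decide (k ≤ n))
    (hne : ∃ n, u n = true) : ∃ j, IsGoodSuffix u j := by
  classical
  obtain ⟨k, hk⟩ : ∃ k, Nat.find hne = k + 1 := by
    refine Nat.exists_eq_succ_of_ne_zero fun h => ?_
    have := Nat.find_spec hne
    simp [h, h0] at this
  have hk1 : u (k + 1) = true := hk ▸ Nat.find_spec hne
  have hlow : ∀ i, i < k + 1 → u i = false := fun i hi =>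
    Bool.eq_false_iff.mpr (Nat.find_min hne (hk ▸ hi))
  obtain ⟨p, hkp, hp, hp'⟩ : ∃ p, k + 1 ≤ p ∧ u p = true ∧ u (p + 1) = false := by
    by_contra! hcon
    refine h01 (k + 1) (funext fun n => ?_)
    by_cases hn : k + 1 ≤ n
    · rw [decide_eq_true hn]
      induction n, hn using Nat.le_induction with
      | base => exact hk1
      | succ n hn ih => exact Bool.not_eq_false _ ▸ hcon n hn ih
    · rw [decide_eq_false hn]
      exact hlow n (by omega)
  exact exists_isGoodSuffix_of_head_false hlow hk1 hkp hp hp'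

/-- Exchange of the two letters in a binary sequence. -/
def flipB (u : ℕ → Bool) : ℕ → Bool := fun n => !u n

theorem flipB_flipB (u : ℕ → Bool) : flipB (flipB u) = u :=
  funext fun n => Bool.not_not (u n)

open Classical in
theorem lexInfSeq_flipB (S : Set (ℕ → Bool)) :
    lexInfSeq {x | flipB x ∈ S} = flipB (lexSupSeq S) := by
  funext n
  induction n using Nat.strong_induction_on with
  | _ n ih =>
    rw [flipB, lexInfSeq, lexSupSeq, ← decide_not]
    refine decide_eq_decide.mpr (not_congr ⟨?_, ?_⟩)
    · rintro ⟨x, hx, hagree, hn⟩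
      refine ⟨flipB x, hx, fun i hi => ?_, by simp [flipB, hn]⟩
      simp [flipB, hagree i hi, ih i hi]
    · rintro ⟨x, hx, hagree, hn⟩
      refine ⟨flipB x, ?_, fun i hi => ?_, by simp [flipB, hn]⟩
      · simpa [flipB_flipB] using hx
      · simp [flipB, hagree i hi, ih i hi]

theorem flipB_eq_iff {u v : ℕ → Bool} : flipB u = v ↔ u = flipB v :=
  ⟨fun h => h ▸ (flipB_flipB u).symm, fun h => h ▸ flipB_flipB v⟩

theorem inf1_flipB (u : ℕ → Bool) : inf1 (flipB u) = flipB (sup0 u) := by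
  rw [inf1, sup0, ← lexInfSeq_flipB]
  congr 1
  ext x
  exact exists_congr fun k => and_congr (by simp [flipB]) flipB_eq_iff.symm

theorem infO_flipB (u : ℕ → Bool) : infO (flipB u) = flipB (supO u) := by
  rw [infO, supO, ← lexInfSeq_flipB]
  congr 1
  ext x
  exact exists_congr fun k => flipB_eq_iff.symm

theorem sup0_flipB (u : ℕ → Bool) : sup0 (flipB u) = flipB (inf1 u) := by
  rw [← flipB_eq_iff, ← inf1_flipB, flipB_flipB]

theorem supO_flipB (u : ℕ → Bool) : supO (flipB u) = flipB (infO u) := by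
  rw [← flipB_eq_iff, ← infO_flipB, flipB_flipB]

theorem IsGoodSuffix.of_flipB {u : ℕ → Bool} {j : ℕ} (h : IsGoodSuffix (flipB u) j) :
    IsGoodSuffix u j := by
  have hinj : Function.Injective flipB := Function.LeftInverse.injective flipB_flipB
  obtain ⟨h1, h2, h3, h4⟩ := h
  change infO (flipB fun i => u (i + j)) = inf1 (flipB fun i => u (i + j)) at h1
  change inf1 (flipB fun i => u (i + j)) = inf1 (flipB u) at h2
  change supO (flipB fun i => u (i + j)) = sup0 (flipB fun i => u (i + j)) at h3
  change sup0 (flipB fun i => u (i + j)) = sup0 (flipB u) at h4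
  rw [infO_flipB, inf1_flipB] at h1
  rw [inf1_flipB, inf1_flipB] at h2
  rw [supO_flipB, sup0_flipB] at h3
  rw [sup0_flipB, sup0_flipB] at h4
  exact ⟨hinj h3, hinj h4, hinj h1, hinj h2⟩

/-- If `u` is neither `0^k 1̄` nor `1^k 0̄` for any `k ≥ 0`, then some suffix `v` of `u`
satisfies `inf O(v) = inf₁(v) = inf₁(u)` and `sup O(v) = sup₀(v) = sup₀(u)`. -/
theorem exists_good_suffix (u : ℕ → Bool)
    (h01 : ∀ k : ℕ, u ≠ fun n => decide (k ≤ n))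
    (h10 : ∀ k : ℕ, u ≠ fun n => decide (n < k)) :
    ∃ j : ℕ,
      infO (fun i => u (i + j)) = inf1 (fun i => u (i + j)) ∧
      inf1 (fun i => u (i + j)) = inf1 u ∧
      supO (fun i => u (i + j)) = sup0 (fun i => u (i + j)) ∧
      sup0 (fun i => u (i + j)) = sup0 u := by
  change ∃ j, IsGoodSuffix u j
  cases h0 : u 0 with
  | false =>
    refine exists_isGoodSuffix_of_zero_false h0 h01 ?_
    by_contra! hcon
    exact h10 0 (funext fun n => by simpa using hcon n)
  | true =>
    obtain ⟨j, hj⟩ : ∃ j, IsGoodSuffix (flipB u) j := by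
      refine exists_isGoodSuffix_of_zero_false (by simp [flipB, h0]) (fun k hk => ?_) ?_
      · refine h10 k ((flipB_eq_iff.mp hk).trans (funext fun n => ?_))
        simp [flipB, ← decide_not]
      · by_contra! hcon
        exact h01 0 (funext fun n => by simpa [flipB] using hcon n)
    exact ⟨j, hj.of_flipB⟩
end
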